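/- arXiv:0906.3376 — 3 statements merged into one kernel-verified Lean document; each statement's English description precedes it below -/
import Mathlib

section
/- Assume N' ≠ 0. For every x ∈ P/Q and n ∈ ℤ^m: (i) any two elements of G(x,n) commute; (ii) every element of G(x,n) is nilpotent; (iii) σ(x,n) ∩ (−σ(x,n)) = {0}; and (iv) σ(x,n) equals the set of all nonnegative-real linear combinations of the finitely many elements N ∈ G(x,n) for which N(e) = s(x) + a(x)^{−1} Σ_j c_j e_j with each c_j ∈ {n_j, n_j + 1}. -/
open Matrix

noncomputable section

/-- Index type for `H = H' ⊕ ℤ` (with `H'` free of rank `d`): `Sum.inl i` indexes the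
`H'`-coordinates and `Sum.inr ()` indexes the extra ℤ-coordinate (the coordinate of `e`). -/
abbrev Idx (d : ℕ) := Sum (Fin d) Unit

/-- `N' = log γ' = Σ_{i≥1} (-1)^{i+1} (γ'-1)^i / i` as a rational `d × d` matrix
(the series is finite: since `γ' - 1` is nilpotent, `(γ'-1)^i = 0` for `i > d`). -/
def logMat (d : ℕ) (γ' : (Matrix (Fin d) (Fin d) ℤ)ˣ) : Matrix (Fin d) (Fin d) ℚ :=
  ∑ i ∈ Finset.Icc 1 d,
    ((-1 : ℚ) ^ (i + 1) / (i : ℚ)) •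
      ((γ' : Matrix (Fin d) (Fin d) ℤ).map (Int.cast : ℤ → ℚ) - 1) ^ i

/-- `P = Im(N' : H'_ℚ → H'_ℚ)`. -/
def Psub (d : ℕ) (γ' : (Matrix (Fin d) (Fin d) ℤ)ˣ) : Submodule ℚ (Fin d → ℚ) :=
  LinearMap.range (logMat d γ').mulVecLin

/-- `Q = Ker(N' : H'_ℚ → H'_ℚ) ∩ P`. -/
def Qsub (d : ℕ) (γ' : (Matrix (Fin d) (Fin d) ℤ)ˣ) : Submodule ℚ (Fin d → ℚ) :=
  LinearMap.ker (logMat d γ').mulVecLin ⊓ Psub d γ'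

/-- `Q` regarded as a submodule of `P` (note `Q ⊆ P`). -/
def QinP (d : ℕ) (γ' : (Matrix (Fin d) (Fin d) ℤ)ˣ) : Submodule ℚ (Psub d γ') :=
  (Qsub d γ').comap (Psub d γ').subtype

/-- The quotient `P/Q`. -/
abbrev PmodQ (d : ℕ) (γ' : (Matrix (Fin d) (Fin d) ℤ)ˣ) :=
  (Psub d γ') ⧸ (QinP d γ')

/-- `a(x)`: the order of the image of `x ∈ P/Q` in `P/((P∩L)+Q)`, i.e. the least positive
integer `a` such that `a • x` is the class of an element of `P ∩ L`. -/
def aOrd (d : ℕ) (γ' : (Matrix (Fin d) (Fin d) ℤ)ˣ) (L : Submodule ℤ (Fin d → ℚ))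
    (x : PmodQ d γ') : ℕ :=
  sInf {a : ℕ | 0 < a ∧ ∃ v : Psub d γ', (v : Fin d → ℚ) ∈ L ∧ (QinP d γ').mkQ v = a • x}

/-- The generating set `G(x,n)` of the cone `σ(x,n)`: all real matrices `N` (identified with
ℝ-linear endomorphisms of `H_ℝ = Idx d → ℝ` via `N.mulVec`) such that `N(H_ℝ) ⊆ H'_ℝ`
(the `Sum.inr`-row vanishes), the restriction of `N` to `H'_ℝ` is `N'` (the `inl × inl` block
is `N'`), and `N(e) = s(x) + a(x)⁻¹ Σ_j c_j e_j` with `n_j ≤ c_j ≤ n_j + 1`. -/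
def Gset (d m : ℕ) (γ' : (Matrix (Fin d) (Fin d) ℤ)ˣ) (L : Submodule ℤ (Fin d → ℚ))
    (s : PmodQ d γ' →ₗ[ℚ] Psub d γ') (E : Fin m → (Fin d → ℚ))
    (x : PmodQ d γ') (n : Fin m → ℤ) : Set (Matrix (Idx d) (Idx d) ℝ) :=
  {N | (∀ j, N (Sum.inr ()) j = 0) ∧
    (∀ i j : Fin d, N (Sum.inl i) (Sum.inl j) = (logMat d γ' i j : ℝ)) ∧
    ∃ c : Fin m → ℝ, (∀ j, (n j : ℝ) ≤ c j ∧ c j ≤ (n j : ℝ) + 1) ∧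
      ∀ i : Fin d, N (Sum.inl i) (Sum.inr ()) =
        (((s x : Psub d γ') : Fin d → ℚ) i : ℝ) +
          ((aOrd d γ' L x : ℝ))⁻¹ * ∑ j, c j * ((E j i : ℝ))}

/-- The set of all finite nonnegative-real linear combinations of elements of `S`. -/
def coneOf {V : Type*} [AddCommMonoid V] [Module ℝ V] (S : Set V) : Set V :=
  {M | ∃ (t : ℕ) (f : Fin t → V) (r : Fin t → ℝ),
    (∀ k, f k ∈ S) ∧ (∀ k, 0 ≤ r k) ∧ M = ∑ k, r k • f k}

/-- The cone `σ(x,n)`: all finite nonnegative-real linear combinations of elements of `G(x,n)`. -/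
def sigmaCone (d m : ℕ) (γ' : (Matrix (Fin d) (Fin d) ℤ)ˣ) (L : Submodule ℤ (Fin d → ℚ))
    (s : PmodQ d γ' →ₗ[ℚ] Psub d γ') (E : Fin m → (Fin d → ℚ))
    (x : PmodQ d γ') (n : Fin m → ℤ) : Set (Matrix (Idx d) (Idx d) ℝ) :=
  coneOf (Gset d m γ' L s E x n)

/-- The weight filtration `W` on `H_ℝ = Idx d → ℝ`: `W_j = H_ℝ` for `j ≥ 0`,
`W_{-1} = H'_ℝ` (the functions vanishing at `Sum.inr ()`), and `W_j = 0` for `j ≤ -2`. -/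
def Wfil (d : ℕ) : ℤ → Submodule ℝ (Idx d → ℝ) := fun j =>
  if 0 ≤ j then ⊤
  else if j = -1 then
    LinearMap.ker (LinearMap.proj (Sum.inr ()) : ((_ : Idx d) → ℝ) →ₗ[ℝ] ℝ)
  else ⊥

/-- `M` is a relative monodromy filtration `M(N, W)`.  The bijectivity of the map
`gr^M_{j+l}(gr^W_j) → gr^M_{j-l}(gr^W_j)` induced by `N^l` is encoded, without forming
quotients, by the two lattice-theoretic conditions: surjectivity is
`M_{j-l} ∩ W_j ⊆ N^l(M_{j+l} ∩ W_j) + (M_{j-l-1} ∩ W_j) + W_{j-1}` and injectivity is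
`(M_{j+l} ∩ W_j) ∩ (N^l)⁻¹((M_{j-l-1} ∩ W_j) + W_{j-1}) ⊆ (M_{j+l-1} ∩ W_j) + W_{j-1}`. -/
def IsRelMonodromyFil {K V : Type*} [Field K] [AddCommGroup V] [Module K V]
    (N : V →ₗ[K] V) (W M : ℤ → Submodule K V) : Prop :=
  Monotone M ∧
  (∃ j₀ : ℤ, ∀ j ≤ j₀, M j = ⊥) ∧
  (∃ j₁ : ℤ, ∀ j, j₁ ≤ j → M j = ⊤) ∧
  (∀ j : ℤ, (M j).map N ≤ M (j - 2)) ∧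
  ∀ (j : ℤ) (l : ℕ),
    (M (j - l) ⊓ W j ≤
      Submodule.map (N ^ l : V →ₗ[K] V) (M (j + l) ⊓ W j) ⊔ (M (j - l - 1) ⊓ W j) ⊔ W (j - 1)) ∧
    ((M (j + l) ⊓ W j) ⊓
        Submodule.comap (N ^ l : V →ₗ[K] V) ((M (j - l - 1) ⊓ W j) ⊔ W (j - 1)) ≤
      (M (j + l - 1) ⊓ W j) ⊔ W (j - 1))

/-- A convex cone in a real vector space: contains `0`, closed under addition and
multiplication by nonnegative reals. -/
def IsConvexConeSet {V : Type*} [AddCommMonoid V] [Module ℝ V] (S : Set V) : Prop :=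
  (0 : V) ∈ S ∧ (∀ u ∈ S, ∀ v ∈ S, u + v ∈ S) ∧ ∀ r : ℝ, 0 ≤ r → ∀ u ∈ S, r • u ∈ S

/-- `F` is a face of the convex cone `S`. -/
def IsFaceOf {V : Type*} [AddCommMonoid V] [Module ℝ V] (F S : Set V) : Prop :=
  IsConvexConeSet F ∧ F ⊆ S ∧ ∀ u ∈ S, ∀ v ∈ S, u + v ∈ F → u ∈ F ∧ v ∈ F

/-- The ray of all nonnegative real multiples of `N`. -/
def rayOf {V : Type*} [AddCommMonoid V] [Module ℝ V] (N : V) : Set V :=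
  {M | ∃ r : ℝ, 0 ≤ r ∧ M = r • N}

end

open scoped NNReal

/-- The matrix on `H_ℝ = H'_ℝ ⊕ ℝ e` acting on `H'_ℝ` by `A` and sending `e` to `w`. -/
def extendByVec {d : ℕ} (A : Matrix (Fin d) (Fin d) ℝ) (w : Fin d → ℝ) :
    Matrix (Idx d) (Idx d) ℝ :=
  Matrix.fromBlocks A (Matrix.replicateCol Unit w) 0 0

theorem eq_extendByVec {d : ℕ} {A : Matrix (Fin d) (Fin d) ℝ} {w : Fin d → ℝ}
    {N : Matrix (Idx d) (Idx d) ℝ} (h₀ : ∀ j, N (Sum.inr ()) j = 0)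
    (h₁ : ∀ i j : Fin d, N (Sum.inl i) (Sum.inl j) = A i j)
    (h₂ : ∀ i : Fin d, N (Sum.inl i) (Sum.inr ()) = w i) : N = extendByVec A w := by
  ext (i | i) (j | j) <;> simp [extendByVec, h₀, h₁, h₂]

theorem extendByVec_mul {d : ℕ} (A B : Matrix (Fin d) (Fin d) ℝ) (v w : Fin d → ℝ) :
    extendByVec A v * extendByVec B w = extendByVec (A * B) (A *ᵥ w) := by
  simp [extendByVec, Matrix.fromBlocks_multiply, Matrix.replicateCol_mulVec]

theorem extendByVec_pow_succ {d : ℕ} (A : Matrix (Fin d) (Fin d) ℝ) (w : Fin d → ℝ) (k : ℕ) :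
    extendByVec A w ^ (k + 1) = extendByVec (A ^ (k + 1)) (A ^ k *ᵥ w) := by
  induction k with
  | zero => simp
  | succ k ih => rw [pow_succ', ih, extendByVec_mul, ← pow_succ', Matrix.mulVec_mulVec, ← pow_succ']

theorem isNilpotent_extendByVec {d : ℕ} {A : Matrix (Fin d) (Fin d) ℝ} (hA : IsNilpotent A)
    (w : Fin d → ℝ) : IsNilpotent (extendByVec A w) := by
  obtain ⟨k, hk⟩ := hA
  refine ⟨k + 1, ?_⟩
  rw [extendByVec_pow_succ, pow_succ, hk]
  ext (i | i) (j | j) <;> simp [extendByVec]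

theorem extendByVec_convexCombination {d : ℕ} (A : Matrix (Fin d) (Fin d) ℝ) (v w : Fin d → ℝ)
    {a b : ℝ} (hab : a + b = 1) :
    extendByVec A (a • v + b • w) = a • extendByVec A v + b • extendByVec A w := by
  ext (i | i) (j | j) <;> simp [extendByVec, ← add_mul, hab]

theorem isNilpotent_logMat {d : ℕ} {γ' : (Matrix (Fin d) (Fin d) ℤ)ˣ}
    (hγ' : IsNilpotent ((γ' : Matrix (Fin d) (Fin d) ℤ) - 1)) : IsNilpotent (logMat d γ') := by
  have h : IsNilpotent ((γ' : Matrix (Fin d) (Fin d) ℤ).map (Int.cast : ℤ → ℚ) - 1) := by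
    simpa only [map_sub, map_one, RingHom.mapMatrix_apply, Int.coe_castRingHom] using hγ'.map (Int.castRingHom ℚ).mapMatrix
  refine Commute.isNilpotent_sum (fun i hi => ?_) fun i j _ _ => ?_
  · exact (h.pow_of_pos (Nat.one_le_iff_ne_zero.1 (Finset.mem_Icc.1 hi).1)).smul _
  · exact ((Commute.refl _).pow_pow i j).smul_left _ |>.smul_right _

theorem coneOf_eq_span {V : Type*} [AddCommMonoid V] [Module ℝ V] (S : Set V) :
    coneOf S = Submodule.span ℝ≥0 S := by
  ext M
  rw [SetLike.mem_coe, Submodule.mem_span_set']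
  constructor
  · rintro ⟨t, f, r, hf, hr, rfl⟩
    exact ⟨t, fun k => ⟨r k, hr k⟩, fun k => ⟨f k, hf k⟩, rfl⟩
  · rintro ⟨t, r, f, rfl⟩
    exact ⟨t, fun k => f k, fun k => r k, fun k => (f k).2, fun k => (r k).2, rfl⟩

/-- A cone generated by a set on which a linear map is constantly equal to a nonzero
vector contains no line. -/
theorem eq_zero_of_mem_coneOf_of_neg_mem {V W : Type*} [AddCommGroup V] [Module ℝ V]
    [AddCommGroup W] [Module ℝ W] {S : Set V} (φ : V →ₗ[ℝ] W) {w : W} (hw : w ≠ 0)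
    (hφ : ∀ v ∈ S, φ v = w) {M : V} (h₁ : M ∈ coneOf S) (h₂ : -M ∈ coneOf S) : M = 0 := by
  obtain ⟨t, f, r, hf, hr, hM⟩ := h₁
  obtain ⟨t', f', r', hf', hr', hM'⟩ := h₂
  have e₁ : φ M = (∑ k, r k) • w := by
    simp [hM, hφ _ (hf _), Finset.sum_smul]
  have e₂ : φ (-M) = (∑ k, r' k) • w := by
    simp [hM', hφ _ (hf' _), Finset.sum_smul]
  have e₃ : ((∑ k, r k) + ∑ k, r' k) • w = 0 := by
    rw [add_smul, ← e₁, ← e₂, map_neg, add_neg_cancel]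
  have e₄ := (smul_eq_zero.1 e₃).resolve_right hw
  have p₁ := Finset.sum_nonneg fun k (_ : k ∈ Finset.univ) => hr k
  have p₂ := Finset.sum_nonneg fun k (_ : k ∈ Finset.univ) => hr' k
  have e₅ : ∑ k, r k = 0 := by linarith
  rw [Finset.sum_eq_zero_iff_of_nonneg fun k _ => hr k] at e₅
  rw [hM]
  exact Finset.sum_eq_zero fun k hk => by rw [e₅ k hk, zero_smul]

theorem convexHull_box_vertices {m : ℕ} (n : Fin m → ℝ) :
    convexHull ℝ {c : Fin m → ℝ | ∀ j, c j = n j ∨ c j = n j + 1} =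
      {c | ∀ j, n j ≤ c j ∧ c j ≤ n j + 1} := by
  have h : {c : Fin m → ℝ | ∀ j, c j = n j ∨ c j = n j + 1} =
      Set.univ.pi fun j => {n j, n j + 1} := by
    ext c; simp
  rw [h, convexHull_pi]
  ext c
  simp [convexHull_pair, segment_eq_Icc, Pi.le_def, forall_and]

open Pointwise in
/-- assuming `N' ≠ 0`: (i) elements of `G(x,n)` commute pairwise; (ii) they are
nilpotent; (iii) `σ(x,n) ∩ (-σ(x,n)) = {0}`; (iv) `σ(x,n)` is generated by the finitely many
elements of `G(x,n)` whose coefficients `c_j` all lie in `{n_j, n_j + 1}`. -/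
theorem stmt5
    (d m : ℕ) (γ' : (Matrix (Fin d) (Fin d) ℤ)ˣ)
    -- `γ' - 1` is nilpotent
    (hγ' : IsNilpotent ((γ' : Matrix (Fin d) (Fin d) ℤ) - 1))
    -- `L`: a finitely generated ℤ-submodule of `H'_ℚ` containing `H' + N'(H')`
    (L : Submodule ℤ (Fin d → ℚ)) (hLfg : L.FG)
    (hLH : ∀ v : Fin d → ℤ, (fun i => (v i : ℚ)) ∈ L)
    (hLN : ∀ v : Fin d → ℤ, (logMat d γ').mulVec (fun i => (v i : ℚ)) ∈ L)
    -- `s`: the ℚ-linear map `P/Q → P` induced by a ℤ-linear section of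
    -- `P∩L → (P∩L)/(Q∩L)`; equivalently, a ℚ-linear section of `P → P/Q`
    -- mapping classes of elements of `P∩L` into `L`
    (s : PmodQ d γ' →ₗ[ℚ] Psub d γ')
    (hs : ∀ x : PmodQ d γ', (QinP d γ').mkQ (s x) = x)
    (hsL : ∀ v : Psub d γ', (v : Fin d → ℚ) ∈ L →
      ((s ((QinP d γ').mkQ v) : Psub d γ') : Fin d → ℚ) ∈ L)
    -- `(e_j)`: a ℤ-basis of `Q ∩ L`
    (E : Fin m → (Fin d → ℚ))
    (hEind : LinearIndependent ℤ E)
    (hEspan : Submodule.span ℤ (Set.range E) = (Qsub d γ').restrictScalars ℤ ⊓ L)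
    -- `N' ≠ 0`
    (hne : logMat d γ' ≠ 0) :
    ∀ (x : PmodQ d γ') (n : Fin m → ℤ),
      (∀ N₁ ∈ Gset d m γ' L s E x n, ∀ N₂ ∈ Gset d m γ' L s E x n, N₁ * N₂ = N₂ * N₁) ∧
      (∀ N ∈ Gset d m γ' L s E x n, IsNilpotent N) ∧
      (sigmaCone d m γ' L s E x n ∩ -sigmaCone d m γ' L s E x n = {0}) ∧
      ({N ∈ Gset d m γ' L s E x n | ∃ c : Fin m → ℝ,
          (∀ j, c j = (n j : ℝ) ∨ c j = (n j : ℝ) + 1) ∧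
          ∀ i : Fin d, N (Sum.inl i) (Sum.inr ()) =
            (((s x : Psub d γ') : Fin d → ℚ) i : ℝ) +
              ((aOrd d γ' L x : ℝ))⁻¹ * ∑ j, c j * ((E j i : ℝ))}).Finite ∧
      sigmaCone d m γ' L s E x n =
        coneOf {N ∈ Gset d m γ' L s E x n | ∃ c : Fin m → ℝ,
          (∀ j, c j = (n j : ℝ) ∨ c j = (n j : ℝ) + 1) ∧
          ∀ i : Fin d, N (Sum.inl i) (Sum.inr ()) =
            (((s x : Psub d γ') : Fin d → ℚ) i : ℝ) +
              ((aOrd d γ' L x : ℝ))⁻¹ * ∑ j, c j * ((E j i : ℝ))} := by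
  intro x n
  set A : Matrix (Fin d) (Fin d) ℝ := (logMat d γ').map (Rat.cast : ℚ → ℝ) with hA
  set vec : (Fin m → ℝ) → Fin d → ℝ := fun c i =>
    (((s x : Psub d γ') : Fin d → ℚ) i : ℝ) +
      ((aOrd d γ' L x : ℝ))⁻¹ * ∑ j, c j * ((E j i : ℝ)) with hvec
  have hG : ∀ N ∈ Gset d m γ' L s E x n, ∃ c : Fin m → ℝ,
      (∀ j, (n j : ℝ) ≤ c j ∧ c j ≤ (n j : ℝ) + 1) ∧ N = extendByVec A (vec c) := by
    rintro N ⟨h₀, h₁, c, hc, h₂⟩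
    exact ⟨c, hc, eq_extendByVec h₀ h₁ h₂⟩
  have hE : ∀ j, A *ᵥ (fun i => (E j i : ℝ)) = 0 := by
    intro j
    have hj : E j ∈ (Qsub d γ').restrictScalars ℤ ⊓ L :=
      hEspan ▸ Submodule.subset_span ⟨j, rfl⟩
    have hj' : logMat d γ' *ᵥ E j = 0 := hj.1.1
    ext i
    have := congrArg (Rat.cast : ℚ → ℝ) (congrFun hj' i)
    simpa [Matrix.mulVec, dotProduct, hA] using this
  have hvec_eq : ∀ c, vec c = (fun i => (((s x : Psub d γ') : Fin d → ℚ) i : ℝ)) +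
      ((aOrd d γ' L x : ℝ))⁻¹ • ∑ j, c j • (fun i => (E j i : ℝ)) := by
    intro c; ext i; simp [hvec]
  have hAvec : ∀ c, A *ᵥ vec c = A *ᵥ fun i => (((s x : Psub d γ') : Fin d → ℚ) i : ℝ) := by
    intro c
    rw [hvec_eq, Matrix.mulVec_add, Matrix.mulVec_smul, Matrix.mulVec_sum]
    simp [Matrix.mulVec_smul, hE]
  have hvec_combo : ∀ (c c' : Fin m → ℝ) (a b : ℝ), a + b = 1 →
      vec (a • c + b • c') = a • vec c + b • vec c' := by
    intro c c' a b hab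
    obtain rfl : b = 1 - a := by linarith
    simp only [hvec_eq, Pi.add_apply, Pi.smul_apply, smul_eq_mul, add_smul, mul_smul,
      Finset.sum_add_distrib, ← Finset.smul_sum]
    module
  set V := {N ∈ Gset d m γ' L s E x n | ∃ c : Fin m → ℝ,
    (∀ j, c j = (n j : ℝ) ∨ c j = (n j : ℝ) + 1) ∧
      ∀ i : Fin d, N (Sum.inl i) (Sum.inr ()) = vec c i} with hV
  refine ⟨?_, ?_, ?_, ?_, ?_⟩
  · intro N₁ h₁ N₂ h₂
    obtain ⟨c₁, -, rfl⟩ := hG N₁ h₁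
    obtain ⟨c₂, -, rfl⟩ := hG N₂ h₂
    rw [extendByVec_mul, extendByVec_mul, hAvec, hAvec]
  · intro N hN
    obtain ⟨c, -, rfl⟩ := hG N hN
    exact isNilpotent_extendByVec
      ((isNilpotent_logMat hγ').map (Rat.castHom ℝ).mapMatrix) _
  · refine Set.Subset.antisymm ?_ ?_
    · rintro M ⟨h₁, h₂⟩
      let φ : Matrix (Idx d) (Idx d) ℝ →ₗ[ℝ] Matrix (Fin d) (Fin d) ℝ :=
        { toFun := Matrix.toBlocks₁₁
          map_add' := fun _ _ => rfl
          map_smul' := fun _ _ => rfl }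
      have hA0 : A ≠ 0 := by
        intro h
        refine hne (Matrix.map_injective Rat.cast_injective (?_ : A = _))
        rw [h]
        simp
      refine eq_zero_of_mem_coneOf_of_neg_mem φ hA0 (fun N hN => ?_) h₁ h₂
      obtain ⟨c, -, rfl⟩ := hG N hN
      exact Matrix.toBlocks_fromBlocks₁₁ ..
    · rintro _ rfl
      have h0 : (0 : Matrix (Idx d) (Idx d) ℝ) ∈ sigmaCone d m γ' L s E x n :=
        ⟨0, Fin.elim0, Fin.elim0, fun k => k.elim0, fun k => k.elim0, by simp⟩
      exact ⟨h0, by simpa using h0⟩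
  · have hfin : {c : Fin m → ℝ | ∀ j, c j = (n j : ℝ) ∨ c j = (n j : ℝ) + 1}.Finite := by
      refine (Set.Finite.pi' fun j => Set.toFinite {(n j : ℝ), (n j : ℝ) + 1}).subset ?_
      intro c hc
      simpa using hc
    refine (hfin.image fun c => extendByVec A (vec c)).subset ?_
    rintro N ⟨⟨h₀, h₁, -⟩, c, hc, h₂⟩
    exact ⟨c, hc, (eq_extendByVec h₀ h₁ h₂).symm⟩
  · rw [sigmaCone, coneOf_eq_span, coneOf_eq_span]
    refine congrArg _ (le_antisymm (Submodule.span_le.2 fun N hN => ?_)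
      (Submodule.span_mono fun N hN => hN.1))
    obtain ⟨c, hc, rfl⟩ := hG N hN
    have hconv : Convex ℝ {c | extendByVec A (vec c) ∈ Submodule.span ℝ≥0 V} := by
      intro c₁ h₁ c₂ h₂ a b ha hb hab
      rw [Set.mem_ofPred_eq, hvec_combo _ _ _ _ hab, extendByVec_convexCombination _ _ _ hab]
      exact add_mem (Submodule.smul_mem _ (⟨a, ha⟩ : ℝ≥0) h₁)
        (Submodule.smul_mem _ (⟨b, hb⟩ : ℝ≥0) h₂)
    have hvert : {c : Fin m → ℝ | ∀ j, c j = (n j : ℝ) ∨ c j = (n j : ℝ) + 1} ⊆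
        {c | extendByVec A (vec c) ∈ Submodule.span ℝ≥0 V} := by
      refine fun c' hc' => Submodule.subset_span
        ⟨⟨fun j => ?_, fun i j => rfl, c', fun j => ?_, fun i => rfl⟩, c', hc', fun i => rfl⟩
      · rcases j with j | j <;> rfl
      · rcases hc' j with h | h <;> rw [h] <;> constructor <;> linarith
    exact convexHull_min hvert hconv ((convexHull_box_vertices fun j => (n j : ℝ)).ge hc)
end

section
/- Let N : H_ℚ → H_ℚ be a ℚ-linear map such that N(H_ℚ) ⊆ H'_ℚ, the restriction of N to H'_ℚ equals N', and N(e) ∈ P. Then there exist x ∈ P/Q and n ∈ ℤ^m such that the ℝ-linear extension of N belongs to G(x,n); in particular, the ray of all nonnegative real multiples of the ℝ-linear extension of N is contained in σ(x,n). -/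
open Matrix

/-- A `ℤ`-submodule of `ℚ^d` containing `ℤ^d` contains a positive multiple of every vector. -/
theorem exists_pos_nsmul_mem_of_int_vectors_mem {d : ℕ} (L : Submodule ℤ (Fin d → ℚ))
    (hL : ∀ v : Fin d → ℤ, (fun i => (v i : ℚ)) ∈ L) (v : Fin d → ℚ) :
    ∃ D : ℕ, 0 < D ∧ D • v ∈ L := by
  refine ⟨∏ i, (v i).den, Finset.prod_pos fun i _ => (v i).den_pos, ?_⟩
  have h : (∏ i, (v i).den) • v =
      fun i => (((v i).num * ∏ k ∈ Finset.univ.erase i, ((v k).den : ℤ) : ℤ) : ℚ) := by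
    funext i
    rw [Pi.smul_apply, ← Finset.mul_prod_erase _ _ (Finset.mem_univ i), nsmul_eq_mul]
    push_cast
    rw [mul_right_comm, Rat.den_mul_eq_num]
  rw [h]
  exact hL _

/-- If `L` contains `ℤ^d`, then every class in `P/Q` has positive order modulo `P ∩ L`. -/
theorem aOrd_pos {d : ℕ} (γ' : (Matrix (Fin d) (Fin d) ℤ)ˣ) (L : Submodule ℤ (Fin d → ℚ))
    (hL : ∀ v : Fin d → ℤ, (fun i => (v i : ℚ)) ∈ L) (x : PmodQ d γ') :
    0 < aOrd d γ' L x := by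
  obtain ⟨p, rfl⟩ := (QinP d γ').mkQ_surjective x
  obtain ⟨D, hD, hDp⟩ := exists_pos_nsmul_mem_of_int_vectors_mem L hL (p : Fin d → ℚ)
  exact (Nat.sInf_mem (s := {a : ℕ | 0 < a ∧ ∃ v : Psub d γ', (v : Fin d → ℚ) ∈ L ∧
    (QinP d γ').mkQ v = a • (QinP d γ').mkQ p})
    ⟨D, hD, D • p, by simpa using hDp, map_nsmul _ _ _⟩).1

/-- Generators of the lattice `V ∩ L` span `V` over `ℚ` when `L` contains `ℤ^d`. -/
theorem exists_rat_combination_of_span_int_eq {d m : ℕ} (L : Submodule ℤ (Fin d → ℚ))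
    (hL : ∀ v : Fin d → ℤ, (fun i => (v i : ℚ)) ∈ L) (V : Submodule ℚ (Fin d → ℚ))
    (E : Fin m → (Fin d → ℚ))
    (hE : Submodule.span ℤ (Set.range E) = V.restrictScalars ℤ ⊓ L)
    {v : Fin d → ℚ} (hv : v ∈ V) : ∃ q : Fin m → ℚ, v = ∑ j, q j • E j := by
  obtain ⟨D, hD, hDv⟩ := exists_pos_nsmul_mem_of_int_vectors_mem L hL v
  have hmem : D • v ∈ Submodule.span ℤ (Set.range E) := by
    rw [hE]
    exact ⟨V.nsmul_mem hv D, hDv⟩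
  obtain ⟨z, hz⟩ := (Submodule.mem_span_range_iff_exists_fun ℤ).1 hmem
  have hD0 : (D : ℚ) ≠ 0 := by exact_mod_cast hD.ne'
  refine ⟨fun j => (D : ℚ)⁻¹ * z j, ?_⟩
  calc v = (D : ℚ)⁻¹ • (D • v) := by
        rw [← Nat.cast_smul_eq_nsmul ℚ, smul_smul, inv_mul_cancel₀ hD0, one_smul]
    _ = ∑ j, ((D : ℚ)⁻¹ * z j) • E j := by
        rw [← hz, Finset.smul_sum]
        exact Finset.sum_congr rfl fun j _ => by
          rw [← Int.cast_smul_eq_zsmul ℚ, smul_smul]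

/-- The cone generated by `S` contains the ray through each element of `S`. -/
theorem rayOf_subset_coneOf {V : Type*} [AddCommMonoid V] [Module ℝ V] {S : Set V} {v : V}
    (hv : v ∈ S) : rayOf v ⊆ coneOf S := by
  rintro _ ⟨r, hr, rfl⟩
  exact ⟨1, fun _ => v, fun _ => r, fun _ => hv, fun _ => hr, by simp⟩

/-- any ℚ-linear `N` with `N(H_ℚ) ⊆ H'_ℚ`, `N|_{H'_ℚ} = N'` and `N(e) ∈ P`
has ℝ-linear extension lying in some `G(x,n)`; in particular its ray is contained in `σ(x,n)`. -/
theorem stmt6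
    (d m : ℕ) (γ' : (Matrix (Fin d) (Fin d) ℤ)ˣ)
    -- `γ' - 1` is nilpotent
    (hγ' : IsNilpotent ((γ' : Matrix (Fin d) (Fin d) ℤ) - 1))
    -- `L`: a finitely generated ℤ-submodule of `H'_ℚ` containing `H' + N'(H')`
    (L : Submodule ℤ (Fin d → ℚ)) (hLfg : L.FG)
    (hLH : ∀ v : Fin d → ℤ, (fun i => (v i : ℚ)) ∈ L)
    (hLN : ∀ v : Fin d → ℤ, (logMat d γ').mulVec (fun i => (v i : ℚ)) ∈ L)
    -- `s`: the ℚ-linear map `P/Q → P` induced by a ℤ-linear section of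
    -- `P∩L → (P∩L)/(Q∩L)`; equivalently, a ℚ-linear section of `P → P/Q`
    -- mapping classes of elements of `P∩L` into `L`
    (s : PmodQ d γ' →ₗ[ℚ] Psub d γ')
    (hs : ∀ x : PmodQ d γ', (QinP d γ').mkQ (s x) = x)
    (hsL : ∀ v : Psub d γ', (v : Fin d → ℚ) ∈ L →
      ((s ((QinP d γ').mkQ v) : Psub d γ') : Fin d → ℚ) ∈ L)
    -- `(e_j)`: a ℤ-basis of `Q ∩ L`
    (E : Fin m → (Fin d → ℚ))
    (hEind : LinearIndependent ℤ E)
    (hEspan : Submodule.span ℤ (Set.range E) = (Qsub d γ').restrictScalars ℤ ⊓ L)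
    -- `N`: a ℚ-linear endomorphism of `H_ℚ`
    (N : Matrix (Idx d) (Idx d) ℚ)
    -- `N(H_ℚ) ⊆ H'_ℚ`
    (hrow : ∀ j, N (Sum.inr ()) j = 0)
    -- the restriction of `N` to `H'_ℚ` is `N'`
    (hres : ∀ i j : Fin d, N (Sum.inl i) (Sum.inl j) = logMat d γ' i j)
    -- `N(e) ∈ P`
    (hNe : (fun i => N (Sum.inl i) (Sum.inr ())) ∈ Psub d γ') :
    ∃ (x : PmodQ d γ') (n : Fin m → ℤ),
      N.map (Rat.cast : ℚ → ℝ) ∈ Gset d m γ' L s E x n ∧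
      rayOf (N.map (Rat.cast : ℚ → ℝ)) ⊆ sigmaCone d m γ' L s E x n := by
  set p : Psub d γ' := ⟨_, hNe⟩
  set x : PmodQ d γ' := (QinP d γ').mkQ p with hx
  have hQ : (p : Fin d → ℚ) - (s x : Psub d γ') ∈ Qsub d γ' := by
    have h : p - s x ∈ QinP d γ' := by
      refine (Submodule.Quotient.mk_eq_zero _).1 ?_
      rw [← Submodule.mkQ_apply, map_sub, hs, ← hx, sub_self]
    exact h
  obtain ⟨q, hq⟩ := exists_rat_combination_of_span_int_eq L hLH _ E hEspan hQ
  have ha : (aOrd d γ' L x : ℝ) ≠ 0 := by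
    exact_mod_cast (aOrd_pos γ' L hLH x).ne'
  let c : Fin m → ℝ := fun j => aOrd d γ' L x * q j
  have hG : N.map (Rat.cast : ℚ → ℝ) ∈ Gset d m γ' L s E x fun j => ⌊c j⌋ := by
    refine ⟨fun j => by simp [hrow], fun i j => by simp [hres], c,
      fun j => ⟨Int.floor_le _, (Int.lt_floor_add_one _).le⟩, fun i => ?_⟩
    have hi : N (Sum.inl i) (Sum.inr ()) =
        ((s x : Psub d γ') : Fin d → ℚ) i + ∑ j, q j * E j i := by
      have h := congrFun hq i
      simp only [Pi.sub_apply, Finset.sum_apply, Pi.smul_apply, smul_eq_mul] at h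
      rw [← h, add_sub_cancel]
    rw [Matrix.map_apply, hi]
    push_cast
    simp only [c, mul_assoc]
    rw [← Finset.mul_sum, inv_mul_cancel_left₀ ha]
  exact ⟨x, _, hG, rayOf_subset_coneOf hG⟩
end

section
/- Let N : V → V be a nilpotent linear endomorphism of a finite-dimensional ℚ-vector space V, and let W' be the monodromy weight filtration of N centered at −1. Then W'_{−2} ⊆ Im(N) and Ker(N) ∩ Im(N) ⊆ W'_{−2}; consequently Im(N) + W'_{−2} = Im(N) and Ker(N) ∩ W'_{−2} = Ker(N) ∩ Im(N). -/
/-- `W'` is the monodromy weight filtration of the nilpotent endomorphism `N`, centered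
at `k`: increasing, exhaustive, `N W'_j ⊆ W'_{j-2}`, and `N^l` induces a bijection
`W'_{k+l}/W'_{k+l-1} → W'_{k-l}/W'_{k-l-1}` for every `l ≥ 0` (bijectivity of the induced
map being encoded by: surjectivity `W'_{k-l} ⊆ N^l(W'_{k+l}) + W'_{k-l-1}` and injectivity
`W'_{k+l} ∩ (N^l)⁻¹(W'_{k-l-1}) ⊆ W'_{k+l-1}`). -/
def IsWeightMonodromyFil {K V : Type*} [Field K] [AddCommGroup V] [Module K V]
    (N : V →ₗ[K] V) (k : ℤ) (W' : ℤ → Submodule K V) : Prop :=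
  Monotone W' ∧
  (∃ j₀ : ℤ, ∀ j ≤ j₀, W' j = ⊥) ∧
  (∃ j₁ : ℤ, ∀ j, j₁ ≤ j → W' j = ⊤) ∧
  (∀ j : ℤ, (W' j).map N ≤ W' (j - 2)) ∧
  ∀ l : ℕ,
    (W' (k - l) ≤ Submodule.map (N ^ l : V →ₗ[K] V) (W' (k + l)) ⊔ W' (k - l - 1)) ∧
    (W' (k + l) ⊓ Submodule.comap (N ^ l : V →ₗ[K] V) (W' (k - l - 1)) ≤ W' (k + l - 1))

namespace IsWeightMonodromyFil

variable {K V : Type*} [Field K] [AddCommGroup V] [Module K V]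
  {N : V →ₗ[K] V} {k : ℤ} {W' : ℤ → Submodule K V}

/-- The step `k - l` of the filtration lies in the range of `N ^ l`. -/
theorem le_range_pow (h : IsWeightMonodromyFil N k W') (l : ℕ) :
    W' (k - l) ≤ LinearMap.range (N ^ l) := by
  obtain ⟨-, ⟨j₀, hbot⟩, -, -, hl⟩ := h
  have descend : ∀ n : ℕ, W' (k - l) ≤ LinearMap.range (N ^ l) ⊔ W' (k - l - n) := by
    intro n
    induction n with
    | zero => simp
    | succ n ih =>
      refine ih.trans (sup_le le_sup_left ?_)
      have hs := (hl (l + n)).1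
      rw [show k - ((l + n : ℕ) : ℤ) = k - l - n by push_cast; ring,
        show k - (l : ℤ) - n - 1 = k - l - ((n + 1 : ℕ) : ℤ) by push_cast; ring] at hs
      refine hs.trans (sup_le_sup_right (LinearMap.map_le_range.trans ?_) _)
      rw [pow_add]
      exact LinearMap.range_comp_le_range (N ^ n) (N ^ l)
  have hd := descend (k - l - j₀).toNat
  rwa [hbot (k - l - (k - l - j₀).toNat) (by omega), sup_bot_eq] at hd

/-- The kernel of `N ^ l` lies in the step `k + l - 1` of the filtration. -/
theorem ker_pow_le (h : IsWeightMonodromyFil N k W') (l : ℕ) :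
    LinearMap.ker (N ^ l) ≤ W' (k + l - 1) := by
  obtain ⟨-, -, ⟨j₁, htop⟩, -, hl⟩ := h
  have descend : ∀ n : ℕ, LinearMap.ker (N ^ l) ⊓ W' (k + l - 1 + n) ≤ W' (k + l - 1) := by
    intro n
    induction n with
    | zero => simp
    | succ n ih =>
      refine (le_inf inf_le_left ?_).trans ih
      rintro x ⟨hx, hxW⟩
      have hi := (hl (l + n)).2
      rw [show k + ((l + n : ℕ) : ℤ) = k + l - 1 + ((n + 1 : ℕ) : ℤ) by push_cast; ring,
        show k + (l : ℤ) - 1 + ((n + 1 : ℕ) : ℤ) - 1 = k + l - 1 + n by push_cast; ring] at hi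
      refine hi ⟨hxW, ?_⟩
      have hx0 : (N ^ (l + n)) x = 0 := by
        rw [add_comm, pow_add, Module.End.mul_apply, LinearMap.mem_ker.mp hx, map_zero]
      exact Submodule.mem_comap.mpr (hx0 ▸ zero_mem _)
  have hd := descend (j₁ - (k + l - 1)).toNat
  rwa [htop _ (by omega), inf_top_eq] at hd

/-- The intersection of the kernel and the range of `N` lies in the step `k - 1`. -/
theorem ker_inf_range_le (h : IsWeightMonodromyFil N k W') :
    LinearMap.ker N ⊓ LinearMap.range N ≤ W' (k - 1) := by
  rintro _ ⟨hx, y, rfl⟩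
  have hy : y ∈ W' (k + (2 : ℕ) - 1) := h.ker_pow_le 2 (by
    rw [LinearMap.mem_ker, pow_two, Module.End.mul_apply]
    exact hx)
  have hNy := h.2.2.2.1 _ (Submodule.mem_map_of_mem hy)
  rwa [show k + ((2 : ℕ) : ℤ) - 1 - 2 = k - 1 by push_cast; ring] at hNy

end IsWeightMonodromyFil

/-- for a nilpotent endomorphism `N` of a finite-dimensional ℚ-vector space
with monodromy weight filtration `W'` centered at `-1`, one has `W'_{-2} ⊆ Im(N)` and
`Ker(N) ∩ Im(N) ⊆ W'_{-2}`; consequently `Im(N) + W'_{-2} = Im(N)` and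
`Ker(N) ∩ W'_{-2} = Ker(N) ∩ Im(N)`. -/
theorem stmt7 (V : Type*) [AddCommGroup V] [Module ℚ V] [FiniteDimensional ℚ V]
    (N : V →ₗ[ℚ] V) (hnil : IsNilpotent N)
    (W' : ℤ → Submodule ℚ V) (hW' : IsWeightMonodromyFil N (-1) W') :
    W' (-2) ≤ LinearMap.range N ∧
    LinearMap.ker N ⊓ LinearMap.range N ≤ W' (-2) ∧
    LinearMap.range N ⊔ W' (-2) = LinearMap.range N ∧
    LinearMap.ker N ⊓ W' (-2) = LinearMap.ker N ⊓ LinearMap.range N := by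
  have hrange : W' (-2) ≤ LinearMap.range N := by simpa using hW'.le_range_pow 1
  have hker : LinearMap.ker N ⊓ LinearMap.range N ≤ W' (-2) := hW'.ker_inf_range_le
  exact ⟨hrange, hker, sup_eq_left.mpr hrange,
    le_antisymm (inf_le_inf_left _ hrange) (le_inf inf_le_left hker)⟩
end
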